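/- There exists a universal constant C > 0 such that for every φ ∈ H¹(ℝ³), ∫_{ℝ³}∫_{ℝ³}∫_{ℝ³} |x−y|^{−1} |x−z|^{−1} |φ(x)|² |φ(y)|² |φ(z)|² dx dy dz ≤ C · ‖φ‖_{H¹}² · ‖φ‖_{L²}⁴. -/

import Mathlib

open MeasureTheory ENNReal

/-- The `H¹(ℝ³)` norm of `φ`, built from the `L²` norms of `φ` and of its
gradient `fderiv ℝ φ`. -/
noncomputable def H1Norm (φ : EuclideanSpace ℝ (Fin 3) → ℂ) : ℝ :=
  Real.sqrt ((eLpNorm φ 2 volume).toReal ^ 2 +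
    (eLpNorm (fun x => fderiv ℝ φ x) 2 volume).toReal ^ 2)

open Set in
/-- One-dimensional local Hardy inequality, set-integral form on `(0,1]`. -/
lemma hardy_one_dim_local (f : ℝ → ℂ) (hf : Differentiable ℝ f) :
    (∫⁻ r in Ioc (0:ℝ) 1, ENNReal.ofReal (‖f r‖ ^ 2)) ≤
      8 * ∫⁻ r in Ioc (0:ℝ) 1, ENNReal.ofReal (r ^ 2 * (‖f r‖ ^ 2 + ‖deriv f r‖ ^ 2)) := by
  set A : ℝ → ℝ := fun r => r ^ 2 * (‖f r‖ ^ 2 + ‖deriv f r‖ ^ 2) with hA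
  have hA0 : ∀ r, 0 ≤ A r := fun r => by positivity
  have hmd : Measurable (deriv f) := measurable_deriv f
  have hmf : Measurable f := hf.continuous.measurable
  have hAm : Measurable A := by fun_prop
  by_cases htop : (∫⁻ r in Ioc (0:ℝ) 1, ENNReal.ofReal (A r)) = ⊤
  · rw [htop]; simp
  have hAi : IntegrableOn A (Ioc 0 1) := by
    refine ⟨hAm.aestronglyMeasurable, ?_⟩
    rw [hasFiniteIntegral_iff_ofReal (Filter.Eventually.of_forall hA0)]
    exact lt_top_iff_ne_top.2 htop
  have hfi : IntegrableOn (fun r => ‖f r‖ ^ 2) (Ioc 0 1) := by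
    have : Continuous (fun r => ‖f r‖ ^ 2) := by
      have := hf.continuous
      fun_prop
    exact (this.integrableOn_Icc (a := 0) (b := 1)).mono_set Ioc_subset_Icc_self
  set G : ℝ → ℝ := fun r => (1 - 2 * r) * ‖f r‖ ^ 2 + (r * (1 - r)) * (2 * inner ℝ (f r) (deriv f r))
    with hG
  have hGm : Measurable G := by
    have h1 : Measurable (fun r => inner ℝ (f r) (deriv f r)) := hmf.inner hmd
    fun_prop
  have hinner : ∀ r, |inner ℝ (f r) (deriv f r)| ≤ ‖f r‖ * ‖deriv f r‖ :=
    fun r => abs_real_inner_le_norm _ _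
  have hcross : ∀ r ∈ Ioc (0:ℝ) 1, |(r * (1 - r)) * (2 * inner ℝ (f r) (deriv f r))| ≤
      2 * (‖f r‖ * (r * ‖deriv f r‖)) := by
    intro r hr
    rw [abs_mul, abs_mul 2, abs_of_nonneg (mul_nonneg hr.1.le (by linarith [hr.2] : 0 ≤ 1 - r)),
      abs_two]
    have h1 := hinner r
    have h2 : r * (1 - r) ≤ r := by nlinarith [hr.1]
    calc r * (1 - r) * (2 * |inner ℝ (f r) (deriv f r)|)
        ≤ r * (2 * (‖f r‖ * ‖deriv f r‖)) := by gcongr; exact hr.1.le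
      _ = _ := by ring
  have hGi : IntegrableOn G (Ioc 0 1) := by
    refine Integrable.mono' ((hfi.const_mul 2).add hAi) hGm.aestronglyMeasurable ?_
    filter_upwards [ae_restrict_mem measurableSet_Ioc] with r hr
    have h1 := hcross r hr
    have h3 : |(1 - 2 * r) * ‖f r‖ ^ 2| ≤ ‖f r‖ ^ 2 := by
      rw [abs_mul, abs_of_nonneg (sq_nonneg ‖f r‖)]
      have : |1 - 2 * r| ≤ 1 := abs_le.2 ⟨by linarith [hr.2], by linarith [hr.1]⟩
      nlinarith [sq_nonneg ‖f r‖]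
    have h4 : ‖G r‖ ≤ |(1 - 2 * r) * ‖f r‖ ^ 2| +
        |(r * (1 - r)) * (2 * inner ℝ (f r) (deriv f r))| := abs_add_le _ _
    simp only [Pi.add_apply, hA]
    nlinarith [sq_nonneg (‖f r‖ - r * ‖deriv f r‖), sq_nonneg (r * ‖f r‖)]
  have hGint : ∫ r in Ioc (0:ℝ) 1, G r = 0 := by
    have hd : ∀ x ∈ uIcc (0:ℝ) 1, HasDerivAt (fun r => (r * (1 - r)) * ‖f r‖ ^ 2) (G x) x := by
      intro x _
      have h1 := (hf x).hasDerivAt.norm_sq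
      have h2 : HasDerivAt (fun r : ℝ => r * (1 - r)) (1 - 2 * x) x := by
        have := (hasDerivAt_id' x).mul ((hasDerivAt_id' x).const_sub 1)
        exact this.congr_deriv (by ring)
      exact h2.mul h1
    have := intervalIntegral.integral_eq_sub_of_hasDerivAt hd
      ((intervalIntegrable_iff_integrableOn_Ioc_of_le zero_le_one).2 hGi)
    rw [intervalIntegral.integral_of_le zero_le_one] at this
    rw [this]; simp
  have key : ∫ r in Ioc (0:ℝ) 1, ‖f r‖ ^ 2 ≤ 8 * ∫ r in Ioc (0:ℝ) 1, A r := by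
    have : ∫ r in Ioc (0:ℝ) 1, ‖f r‖ ^ 2 ≤ ∫ r in Ioc (0:ℝ) 1, (2 * G r + 8 * A r) := by
      refine setIntegral_mono_on hfi ((hGi.const_mul 2).add (hAi.const_mul 8)) measurableSet_Ioc ?_
      intro r hr
      have h1 := (abs_le.1 (hcross r hr)).1
      simp only [hA, hG]
      nlinarith [sq_nonneg (‖f r‖ - 4 * (r * ‖deriv f r‖)), sq_nonneg (‖f r‖ - 4 * (r * ‖f r‖))]
    rw [integral_add (hGi.const_mul 2) (hAi.const_mul 8), integral_const_mul, integral_const_mul,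
      hGint] at this
    linarith
  rw [← ofReal_integral_eq_lintegral_ofReal hfi (Filter.Eventually.of_forall fun r => by positivity),
    ← ofReal_integral_eq_lintegral_ofReal hAi (Filter.Eventually.of_forall hA0)]
  rw [show (8:ℝ≥0∞) = ENNReal.ofReal 8 by simp, ← ENNReal.ofReal_mul (by norm_num)]
  exact ENNReal.ofReal_le_ofReal key

open Set in
lemma hardy_one_dim (f : ℝ → ℂ) (hf : Differentiable ℝ f) :
    (∫⁻ r in Ioi (0:ℝ), ENNReal.ofReal (‖f r‖ ^ 2)) ≤
      8 * ∫⁻ r in Ioi (0:ℝ), ENNReal.ofReal (r ^ 2 * (‖f r‖ ^ 2 + ‖deriv f r‖ ^ 2)) := by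
  rw [← Ioc_union_Ioi_eq_Ioi (zero_le_one (α := ℝ)),
    lintegral_union measurableSet_Ioi (Ioc_disjoint_Ioi le_rfl),
    lintegral_union measurableSet_Ioi (Ioc_disjoint_Ioi le_rfl), mul_add]
  refine add_le_add (hardy_one_dim_local f hf) ?_
  refine le_trans ?_ (le_mul_of_one_le_left (zero_le) (by norm_num : (1:ℝ≥0∞) ≤ 8))
  refine setLIntegral_mono' measurableSet_Ioi fun r hr => ENNReal.ofReal_le_ofReal ?_
  have hr : 1 < r := hr
  have h1 : 1 ≤ r ^ 2 := by nlinarith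
  nlinarith [sq_nonneg ‖f r‖, sq_nonneg ‖deriv f r‖, mul_nonneg (sq_nonneg r) (sq_nonneg ‖deriv f r‖)]

open Set in
lemma lintegral_polar3 (F : EuclideanSpace ℝ (Fin 3) → ℝ≥0∞) (hF : Measurable F) :
    ∫⁻ x, F x = ∫⁻ ω : Metric.sphere (0 : EuclideanSpace ℝ (Fin 3)) 1,
      (∫⁻ r in Ioi (0:ℝ), ENNReal.ofReal (r ^ 2) * F (r • ω.1))
        ∂((volume : Measure (EuclideanSpace ℝ (Fin 3))).toSphere) := by
  set μ : Measure (EuclideanSpace ℝ (Fin 3)) := volume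
  have hdim : Module.finrank ℝ (EuclideanSpace ℝ (Fin 3)) - 1 = 2 := by simp
  have hmp := μ.measurePreserving_homeomorphUnitSphereProd
  rw [hdim] at hmp
  have hG : Measurable (fun p : Metric.sphere (0 : EuclideanSpace ℝ (Fin 3)) 1 × Ioi (0:ℝ) =>
      F (p.2.1 • p.1.1)) := by
    refine hF.comp ?_
    fun_prop
  calc ∫⁻ x, F x ∂μ
      = ∫⁻ x : ({0}ᶜ : Set (EuclideanSpace ℝ (Fin 3))), F x.1 ∂(μ.comap (↑)) := by
        rw [lintegral_subtype_comap (measurableSet_singleton _).compl, restrict_compl_singleton]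
    _ = ∫⁻ p, F (p.2.1 • p.1.1) ∂(μ.toSphere.prod (Measure.volumeIoiPow 2)) := by
        rw [← hmp.lintegral_comp hG]
        refine lintegral_congr fun x => ?_
        have hx : ‖x.1‖ ≠ 0 := norm_ne_zero_iff.2 x.2
        simp [smul_smul, hx]
    _ = _ := by
        rw [lintegral_prod _ hG.aemeasurable]
        refine lintegral_congr fun ω => ?_
        rw [Measure.volumeIoiPow, lintegral_withDensity_eq_lintegral_mul
          (g := fun y : Ioi (0:ℝ) => F (y.1 • ω.1)) _ (by fun_prop)
          (hG.comp measurable_prodMk_left)]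
        exact lintegral_subtype_comap measurableSet_Ioi
          (fun r : ℝ => ENNReal.ofReal (r ^ 2) * F (r • ω.1))

open Set in
lemma hardy_three (ψ : EuclideanSpace ℝ (Fin 3) → ℂ) (hψ : Differentiable ℝ ψ) :
    ∫⁻ y, ENNReal.ofReal (‖y‖⁻¹ ^ 2 * ‖ψ y‖ ^ 2) ≤
      8 * ∫⁻ y, ENNReal.ofReal (‖ψ y‖ ^ 2 + ‖fderiv ℝ ψ y‖ ^ 2) := by
  have hmf : Measurable ψ := hψ.continuous.measurable
  have hmd : Measurable (fderiv ℝ ψ) := measurable_fderiv ℝ ψ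
  rw [lintegral_polar3 _ (by fun_prop), lintegral_polar3 _ (by fun_prop),
    ← lintegral_const_mul' _ _ (by simp)]
  refine lintegral_mono fun ω => ?_
  have hω : ‖ω.1‖ = 1 := by simp
  have hc : ∀ r : ℝ, HasDerivAt (fun r : ℝ => ψ (r • ω.1)) (fderiv ℝ ψ (r • ω.1) ω.1) r := by
    intro r
    have h1 : HasDerivAt (fun r : ℝ => r • ω.1) ω.1 r := by
      simpa using (hasDerivAt_id r).smul_const ω.1
    exact (hψ _).hasFDerivAt.comp_hasDerivAt r h1
  have h := hardy_one_dim (fun r => ψ (r • ω.1)) (fun r => (hc r).differentiableAt)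
  calc _ = ∫⁻ r in Ioi (0:ℝ), ENNReal.ofReal (‖ψ (r • ω.1)‖ ^ 2) := by
        refine setLIntegral_congr_fun measurableSet_Ioi fun r hr => ?_
        have hr : 0 < r := hr
        rw [← ENNReal.ofReal_mul (by positivity), norm_smul, hω, Real.norm_of_nonneg hr.le]
        congr 1
        field_simp
    _ ≤ _ := h
    _ ≤ _ := by
        gcongr with r
        rw [← ENNReal.ofReal_mul (by positivity)]
        refine ENNReal.ofReal_le_ofReal ?_
        gcongr
        rw [(hc r).deriv]
        simpa [hω] using (fderiv ℝ ψ (r • ω.1)).le_opNorm ω.1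

lemma hardy_translate (φ : EuclideanSpace ℝ (Fin 3) → ℂ) (hφ : Differentiable ℝ φ)
    (x : EuclideanSpace ℝ (Fin 3)) :
    ∫⁻ y, ENNReal.ofReal (‖x - y‖⁻¹ ^ 2 * ‖φ y‖ ^ 2) ≤
      8 * ∫⁻ y, ENNReal.ofReal (‖φ y‖ ^ 2 + ‖fderiv ℝ φ y‖ ^ 2) := by
  have h := hardy_three (fun y => φ (y + x)) (by fun_prop)
  simp only [fderiv_comp_add_right] at h
  rw [lintegral_add_right_eq_self
    (fun y => ENNReal.ofReal (‖φ y‖ ^ 2 + ‖fderiv ℝ φ y‖ ^ 2)) x] at h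
  rw [← lintegral_add_right_eq_self _ x]
  simpa [norm_neg] using h

lemma sq_eLpNorm_two {F : Type*} [NormedAddCommGroup F] (g : EuclideanSpace ℝ (Fin 3) → F) :
    ∫⁻ y, ENNReal.ofReal (‖g y‖ ^ 2) = eLpNorm g 2 volume ^ 2 := by
  have := eLpNorm_nnreal_pow_eq_lintegral (f := g) (μ := (volume : Measure (EuclideanSpace ℝ (Fin 3)))) (p := 2) (by norm_num)
  simp only [NNReal.coe_ofNat, ENNReal.rpow_ofNat, ENNReal.coe_ofNat] at this
  rw [this]
  simp [ENNReal.ofReal_pow, ofReal_norm]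

theorem quintic_coulomb_bound_H1_sq :
    ∃ C : ℝ, 0 < C ∧
      ∀ φ : EuclideanSpace ℝ (Fin 3) → ℂ,
        Differentiable ℝ φ →
        MemLp φ 2 volume →
        MemLp (fun x => fderiv ℝ φ x) 2 volume →
        (∫⁻ x, ∫⁻ y, ∫⁻ z,
            ENNReal.ofReal (‖x - y‖⁻¹ * ‖x - z‖⁻¹) *
              ((‖φ x‖₊ : ℝ≥0∞) ^ 2 * (‖φ y‖₊ : ℝ≥0∞) ^ 2 * (‖φ z‖₊ : ℝ≥0∞) ^ 2))
          ≤ ENNReal.ofReal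
              (C * H1Norm φ ^ 2 * (eLpNorm φ 2 volume).toReal ^ 4) := by
  refine ⟨16, by norm_num, fun φ hφ h2 h2' => ?_⟩
  have hmf : Measurable φ := hφ.continuous.measurable
  have hmd : Measurable (fderiv ℝ φ) := measurable_fderiv ℝ φ
  set P : EuclideanSpace ℝ (Fin 3) → ℝ≥0∞ := fun x => ENNReal.ofReal (‖φ x‖ ^ 2) with hP
  have hPm : Measurable P := by fun_prop
  have hPe : ∀ x, (‖φ x‖₊ : ℝ≥0∞) ^ 2 = P x := fun x => by
    simp [hP, ENNReal.ofReal_pow, ofReal_norm, enorm]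
  set K : EuclideanSpace ℝ (Fin 3) → EuclideanSpace ℝ (Fin 3) → ℝ≥0∞ :=
    fun x y => ENNReal.ofReal (‖x - y‖⁻¹ ^ 2) with hK
  have hKm : ∀ x, Measurable (K x) := fun x => by fun_prop
  have hKP : ∀ x, Measurable (fun y => K x y * P y) := fun x => (hKm x).mul hPm
  set N : ℝ≥0∞ := ∫⁻ y, P y with hN
  set M : ℝ≥0∞ := 8 * ∫⁻ y, ENNReal.ofReal (‖φ y‖ ^ 2 + ‖fderiv ℝ φ y‖ ^ 2) with hM
  have hH : ∀ x, ∫⁻ y, K x y * P y ≤ M := fun x => by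
    refine le_trans (le_of_eq ?_) (hardy_translate φ hφ x)
    refine lintegral_congr fun y => ?_
    simp only [hK, hP]
    rw [ENNReal.ofReal_mul (by positivity)]
  have step : ∀ x y z, ENNReal.ofReal (‖x - y‖⁻¹ * ‖x - z‖⁻¹) *
      ((‖φ x‖₊ : ℝ≥0∞) ^ 2 * (‖φ y‖₊ : ℝ≥0∞) ^ 2 * (‖φ z‖₊ : ℝ≥0∞) ^ 2) ≤
      P x * (K x y * P y) * P z + P x * P y * (K x z * P z) := by
    intro x y z
    rw [hPe, hPe, hPe]
    calc _ ≤ (K x y + K x z) * (P x * P y * P z) := by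
          gcongr
          simp only [hK]
          rw [← ENNReal.ofReal_add (by positivity) (by positivity)]
          refine ENNReal.ofReal_le_ofReal ?_
          nlinarith [sq_nonneg (‖x - y‖⁻¹ - ‖x - z‖⁻¹), sq_nonneg (‖x - y‖⁻¹ + ‖x - z‖⁻¹)]
      _ = _ := by ring
  have main : (∫⁻ x, ∫⁻ y, ∫⁻ z,
            ENNReal.ofReal (‖x - y‖⁻¹ * ‖x - z‖⁻¹) *
              ((‖φ x‖₊ : ℝ≥0∞) ^ 2 * (‖φ y‖₊ : ℝ≥0∞) ^ 2 * (‖φ z‖₊ : ℝ≥0∞) ^ 2)) ≤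
      N * (2 * M * N) := by
    calc _ ≤ ∫⁻ x, ∫⁻ y, ∫⁻ z, (P x * (K x y * P y) * P z + P x * P y * (K x z * P z)) := by
          gcongr with x y z
          exact step x y z
      _ ≤ ∫⁻ x, ∫⁻ y, P x * ((K x y * P y) * N + P y * M) := by
          gcongr with x y
          rw [lintegral_add_left (by fun_prop), lintegral_const_mul _ hPm,
            lintegral_const_mul _ (hKP x), mul_add, ← mul_assoc (P x) _ N, ← mul_assoc (P x) (P y) M]
          exact add_le_add le_rfl (mul_le_mul_right (hH x) _)
      _ ≤ ∫⁻ x, P x * (2 * M * N) := by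
          gcongr with x
          rw [lintegral_const_mul _ (by have := hKm x; fun_prop)]
          gcongr
          rw [lintegral_add_left (by have := hKm x; fun_prop),
            lintegral_mul_const _ (hKP x), lintegral_mul_const _ hPm, two_mul, add_mul]
          refine add_le_add ?_ (le_of_eq (mul_comm _ _))
          gcongr
          exact hH x
      _ = _ := by rw [lintegral_mul_const _ hPm]
  refine main.trans (le_of_eq ?_)
  have hM' : M = 8 * (eLpNorm φ 2 volume ^ 2 + eLpNorm (fun x => fderiv ℝ φ x) 2 volume ^ 2) := by
    rw [hM, ← sq_eLpNorm_two, ← sq_eLpNorm_two, ← lintegral_add_left (by fun_prop)]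
    congr 1
    refine lintegral_congr fun y => ?_
    rw [ENNReal.ofReal_add (by positivity) (by positivity)]
  have hN' : N = eLpNorm φ 2 volume ^ 2 := sq_eLpNorm_two φ
  rw [hM', hN', H1Norm, Real.sq_sqrt (by positivity)]
  have hta := h2.2.ne
  have htb := h2'.2.ne
  generalize eLpNorm φ 2 volume = a at *
  generalize eLpNorm (fun x => fderiv ℝ φ x) 2 volume = b at *
  lift a to NNReal using hta
  lift b to NNReal using htb
  simp only [ENNReal.coe_toReal]
  rw [show (16 * ((a:ℝ) ^ 2 + (b:ℝ) ^ 2) * (a:ℝ) ^ 4) =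
    ((16 * (a ^ 2 + b ^ 2) * a ^ 4 : NNReal) : ℝ) by push_cast; ring, ENNReal.ofReal_coe_nnreal]
  push_cast
  ring
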